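/- arXiv:1404.1022 — 2 statements merged into one kernel-verified Lean document; each statement's English description precedes it below -/
import Mathlib

section
/- Let φ ∈ ℂ(x) be a nonzero rational function over ℂ satisfying the functional equation φ(x/(x−1)) = φ(x), i.e., φ composed with the Möbius transformation x ↦ x/(x−1) equals φ as rational functions. Then there exists a rational function ρ of one variable such that φ(x) = ρ(x²/(1−x)); equivalently, there exist polynomials P, Q ∈ ℂ[y] with Q ≠ 0 such that φ(x) · Q(x²/(1−x)) = P(x²/(1−x)) holds in the field of rational functions ℂ(x), where P(x²/(1−x)) denotes the evaluation of the polynomial P at the element x²/(1−x) of ℂ(x). -/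
/-- Composition `φ(r)` of a rational function `φ` with a rational function `r`: substitute `r`
into the numerator and denominator of `φ`. -/
noncomputable def ratComp (φ r : RatFunc ℂ) : RatFunc ℂ :=
  Polynomial.aeval r φ.num / Polynomial.aeval r φ.denom

theorem RatFunc.X_ne_algebraMap {K : Type*} [Field K] (c : K) :
    (RatFunc.X : RatFunc K) ≠ algebraMap K (RatFunc K) c := by
  intro h
  rw [← RatFunc.algebraMap_X, RatFunc.algebraMap_eq_C, ← RatFunc.algebraMap_C] at h
  exact Polynomial.X_ne_C c (RatFunc.algebraMap_injective K h)

/-- If `x` and `y` are both roots of `z² + t z - t`, then a polynomial evaluated at `x` and `y`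
reduces to the same linear polynomial with coefficients polynomial in `t`. -/
theorem Polynomial.exists_aeval_eq_linear {R A : Type*} [CommRing R] [CommRing A] [Algebra R A]
    {x y t : A} (hx : x ^ 2 = t * (1 - x)) (hy : y ^ 2 = t * (1 - y)) (p : Polynomial R) :
    ∃ a b : Polynomial R,
      aeval x p = aeval t a + aeval t b * x ∧ aeval y p = aeval t a + aeval t b * y := by
  induction p using Polynomial.induction_on' with
  | add p q hp hq =>
    obtain ⟨a, b, h₁, h₂⟩ := hp
    obtain ⟨c, d, h₃, h₄⟩ := hq
    refine ⟨a + c, b + d, ?_, ?_⟩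
    · simp only [map_add, h₁, h₃]
      ring
    · simp only [map_add, h₂, h₄]
      ring
  | monomial n r =>
    induction n with
    | zero => exact ⟨C r, 0, by simp, by simp⟩
    | succ n ih =>
      obtain ⟨a, b, h₁, h₂⟩ := ih
      refine ⟨X * b, a - X * b, ?_, ?_⟩
      · rw [← monomial_mul_X, map_mul, h₁]
        simp only [map_mul, map_sub, aeval_X]
        linear_combination aeval t b * hx
      · rw [← monomial_mul_X, map_mul, h₂]
        simp only [map_mul, map_sub, aeval_X]
        linear_combination aeval t b * hy

/-- If a nonzero rational function `φ ∈ ℂ(x)` satisfies `φ(x/(x-1)) = φ(x)`, then `φ` is a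
rational function of `x²/(1-x)`: there are polynomials `P, Q` with `Q ≠ 0` and
`φ(x) · Q(x²/(1-x)) = P(x²/(1-x))` in `ℂ(x)`. -/
theorem moebius_invariant_ratfunc_is_ratfunc_of_xsq_div_one_sub_x
    (φ : RatFunc ℂ) (hφ : φ ≠ 0)
    (h : ratComp φ (RatFunc.X / (RatFunc.X - 1)) = φ) :
    ∃ P Q : Polynomial ℂ, Q ≠ 0 ∧
      φ * Polynomial.aeval (RatFunc.X ^ 2 / (1 - RatFunc.X)) Q
        = Polynomial.aeval (RatFunc.X ^ 2 / (1 - RatFunc.X)) P := by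
  have h₁ : (RatFunc.X : RatFunc ℂ) - 1 ≠ 0 :=
    sub_ne_zero.2 (by simpa using RatFunc.X_ne_algebraMap (1 : ℂ))
  have h₁' : 1 - (RatFunc.X : RatFunc ℂ) ≠ 0 := by
    rw [← neg_sub]
    exact neg_ne_zero.2 h₁
  have h₂ : (RatFunc.X : RatFunc ℂ) - 2 ≠ 0 :=
    sub_ne_zero.2 (map_ofNat (algebraMap ℂ (RatFunc ℂ)) 2 ▸ RatFunc.X_ne_algebraMap (2 : ℂ))
  have hne : (RatFunc.X : RatFunc ℂ) - RatFunc.X / (RatFunc.X - 1) ≠ 0 := by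
    have : (RatFunc.X : RatFunc ℂ) - RatFunc.X / (RatFunc.X - 1)
        = RatFunc.X * (RatFunc.X - 2) / (RatFunc.X - 1) := by
      field_simp
      ring
    rw [this]
    exact div_ne_zero (mul_ne_zero RatFunc.X_ne_zero h₂) h₁
  have hX : (RatFunc.X : RatFunc ℂ) ^ 2
      = RatFunc.X ^ 2 / (1 - RatFunc.X) * (1 - RatFunc.X) := by
    field_simp
  have hY : (RatFunc.X / (RatFunc.X - 1) : RatFunc ℂ) ^ 2
      = RatFunc.X ^ 2 / (1 - RatFunc.X) * (1 - RatFunc.X / (RatFunc.X - 1)) := by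
    field_simp
    ring
  have hD' : Polynomial.aeval (RatFunc.X / (RatFunc.X - 1) : RatFunc ℂ) φ.denom ≠ 0 := by
    intro h0
    rw [ratComp, h0, div_zero] at h
    exact hφ h.symm
  rw [ratComp, div_eq_iff hD'] at h
  have hD : Polynomial.aeval (RatFunc.X : RatFunc ℂ) φ.denom ≠ 0 := by
    rw [RatFunc.aeval_X_left_eq_algebraMap]
    exact RatFunc.algebraMap_ne_zero φ.denom_ne_zero
  have hN : Polynomial.aeval (RatFunc.X : RatFunc ℂ) φ.num
      = φ * Polynomial.aeval (RatFunc.X : RatFunc ℂ) φ.denom := by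
    rw [← div_eq_iff hD, RatFunc.aeval_X_left_eq_algebraMap, RatFunc.aeval_X_left_eq_algebraMap]
    exact RatFunc.num_div_denom φ
  obtain ⟨a, b, hab, hab'⟩ := Polynomial.exists_aeval_eq_linear hX hY φ.num
  obtain ⟨c, d, hcd, hcd'⟩ := Polynomial.exists_aeval_eq_linear hX hY φ.denom
  rw [hab', hcd'] at h
  rw [hab, hcd] at hN
  rw [hcd] at hD
  have hdb : φ * Polynomial.aeval (RatFunc.X ^ 2 / (1 - RatFunc.X)) d
      = Polynomial.aeval (RatFunc.X ^ 2 / (1 - RatFunc.X)) b :=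
    mul_right_cancel₀ hne (by linear_combination h - hN)
  by_cases hd : d = 0
  · subst hd
    rw [map_zero, mul_zero] at hdb
    refine ⟨a, c, ?_, ?_⟩
    · rintro rfl
      simp at hD
    · rw [map_zero, ← hdb] at hN
      linear_combination -hN
  · exact ⟨b, d, hd, hdb⟩
end

section
/- For every integer n ≥ 1, the polynomial identity Σ_{k=0}^{n−1} binom(n−1, k) · binom(2k, k) · t^k · (1−t)^{2(n−1−k)} = Σ_{k=0}^{n−1} binom(n−1, k)² · t^{2k} holds in the polynomial ring ℂ[t]. (This identity verifies, via Corollary 1.5, that the Hilbert series (1−t²)^{−(2n−2)} Σ_{k=0}^{n−1} binom(n−1,k)² t^{2k} of the symplectic quotient of ℂ^n by the circle acting with weights (±1, …, ±1) is symplectic at t = 1 of order 2n−2: it equals (1−t)^{−(2n−2)} ρ((1−t)²/t) for ρ(y) = (y+4)^{−(n−1)} Σ_{k=0}^{n−1} binom(n−1,k) binom(2k,k) y^{n−k−1}.) -/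
theorem Polynomial.coeff_one_add_C_mul_X_pow {R : Type*} [CommRing R] (a : R) (n k : ℕ) :
    ((1 + Polynomial.C a * Polynomial.X) ^ n).coeff k = (n.choose k : R) * a ^ k := by
  have h : (1 + Polynomial.C a * Polynomial.X) ^ n =
      ((1 + Polynomial.X : Polynomial R) ^ n).comp (Polynomial.C a * Polynomial.X) := by simp
  rw [h, Polynomial.comp_C_mul_X_coeff, Polynomial.coeff_one_add_X_pow]

/-- Both sides are the coefficient of `X ^ m` in
`((1 + t X)² + (1 - t)² X) ^ m = (1 + t² X) ^ m * (1 + X) ^ m`. -/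
theorem sum_choose_mul_choose_two_mul_mul_pow {R : Type*} [CommRing R] (t : R) (m : ℕ) :
    ∑ k ∈ Finset.range (m + 1),
        (m.choose k : R) * ((2 * k).choose k : R) * t ^ k * (1 - t) ^ (2 * (m - k)) =
      ∑ k ∈ Finset.range (m + 1), (m.choose k : R) ^ 2 * t ^ (2 * k) := by
  have key : ((1 + Polynomial.C t * Polynomial.X) ^ 2 +
        Polynomial.C ((1 - t) ^ 2) * Polynomial.X) ^ m =
      (1 + Polynomial.C (t ^ 2) * Polynomial.X) ^ m * (1 + Polynomial.X) ^ m := by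
    rw [← mul_pow]
    congr 1
    simp only [map_pow, map_sub, map_one]
    ring
  have h := congrArg (fun p => Polynomial.coeff p m) key
  convert h using 1
  · rw [add_pow, Polynomial.finsetSum_coeff]
    refine Finset.sum_congr rfl fun k hk => ?_
    have hkm : k ≤ m := Nat.lt_succ_iff.mp (Finset.mem_range.mp hk)
    have hterm : ((1 + Polynomial.C t * Polynomial.X) ^ 2) ^ k *
          (Polynomial.C ((1 - t) ^ 2) * Polynomial.X) ^ (m - k) * (m.choose k : Polynomial R) =
        Polynomial.C ((m.choose k : R) * (1 - t) ^ (2 * (m - k))) *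
          (1 + Polynomial.C t * Polynomial.X) ^ (2 * k) * Polynomial.X ^ (m - k) := by
      simp only [map_mul, map_pow, map_natCast, mul_pow, pow_mul]
      ring
    rw [hterm, Polynomial.coeff_mul_X_pow', if_pos (Nat.sub_le m k), Nat.sub_sub_self hkm,
      Polynomial.coeff_C_mul, Polynomial.coeff_one_add_C_mul_X_pow]
    ring
  · rw [Polynomial.coeff_mul, Finset.Nat.sum_antidiagonal_eq_sum_range_succ_mk]
    refine Finset.sum_congr rfl fun k hk => ?_
    have hkm : k ≤ m := Nat.lt_succ_iff.mp (Finset.mem_range.mp hk)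
    rw [Polynomial.coeff_one_add_C_mul_X_pow, Polynomial.coeff_one_add_X_pow,
      Nat.choose_symm hkm, ← pow_mul]
    ring

/-- The polynomial identity
`Σ_{k=0}^{n-1} binom(n-1,k) binom(2k,k) t^k (1-t)^{2(n-1-k)} = Σ_{k=0}^{n-1} binom(n-1,k)² t^{2k}`
in `ℂ[t]`, verifying that the Hilbert series of the symplectic quotient of `ℂ^n` by the circle
acting with weights `(±1, …, ±1)` is symplectic at `t = 1` of order `2n - 2`. -/
theorem circle_weights_one_identity (n : ℕ) (hn : 1 ≤ n) :
    ∑ k ∈ Finset.range n,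
        Polynomial.C (((n - 1).choose k : ℂ)) * Polynomial.C (((2 * k).choose k : ℂ)) *
          Polynomial.X ^ k * (1 - Polynomial.X) ^ (2 * (n - 1 - k)) =
      ∑ k ∈ Finset.range n,
        Polynomial.C ((((n - 1).choose k : ℂ)) ^ 2) * Polynomial.X ^ (2 * k) := by
  obtain ⟨m, rfl⟩ : ∃ m, n = m + 1 := ⟨n - 1, by omega⟩
  simpa using sum_choose_mul_choose_two_mul_mul_pow (Polynomial.X : Polynomial ℂ) m
end
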